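/- arXiv:2503.21752 — 2 statements merged into one kernel-verified Lean document; each statement's English description precedes it below -/
import Mathlib

section
/- For a spanning hyperforest $F$ of a $(d+1)$-uniform hypergraph $H$ on vertex set $V$, the cardinality of the torsion subgroup of $\tilde H_{d-1}(F;\mathbb{Z})$ equals the index $[B_{d-1}(F;\mathbb{R}) \cap Z_{d-1}(H;\mathbb{Z}) : B_{d-1}(F;\mathbb{Z})]$. -/
open Finset

variable {V : Type} [Fintype V] [LinearOrder V]

/-- Incidence number between a simplex `σ` and a codimension-one face `τ`:
`(-1)^i` where `i` is the position of the vertex `σ \ τ` in the increasing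
ordering of `σ`, and `0` if `τ` is not a codimension-one face of `σ`. -/
def inc (σ τ : Finset V) : ℤ :=
  if τ ⊆ σ ∧ σ.card = τ.card + 1 then
    ∑ v ∈ σ \ τ, (-1 : ℤ) ^ ((σ.filter (fun x => x < v)).card)
  else 0

/-- The augmented chain group of the simplicial complex `S` in (augmented) degree `k`:
the free module on the simplices of `S` having `k` vertices (so `k = 0` corresponds to
the empty simplex, and geometric dimension `k - 1`).  A basis simplex corresponds to the
oriented simplex `(v_0 v_1 ⋯)` with vertices listed in increasing order. -/
abbrev Chain (R : Type) [CommRing R] (S : Finset (Finset V)) (k : ℕ) : Type :=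
  {σ : Finset V // σ ∈ S ∧ σ.card = k} → R

/-- The simplicial boundary map (augmented: in lowest degree it is the augmentation
sending every vertex to `1`).  `bdry R S k : C_k → C_{k-1}` in the usual (geometric)
indexing of the paper. -/
def bdry (R : Type) [CommRing R] (S : Finset (Finset V)) (k : ℕ) :
    Chain R S (k + 1) →ₗ[R] Chain R S k :=
  LinearMap.pi fun τ => ∑ σ : {σ : Finset V // σ ∈ S ∧ σ.card = k + 1},
    (inc σ.1 τ.1 : R) • LinearMap.proj σ

/-- `S` is (the set of simplices of) a simplicial complex with vertex set `V`,
augmented with the empty simplex. -/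
def IsComplex (S : Finset (Finset V)) : Prop :=
  ∅ ∈ S ∧ (∀ σ ∈ S, ∀ τ ⊆ σ, τ ∈ S) ∧ ∀ v : V, {v} ∈ S

/-- The simplicial complex associated to a `(d+1)`-uniform hypergraph with edge set `E`:
the full `(d-1)`-skeleton on the vertex set together with the edges. -/
def cx (E : Finset (Finset V)) (d : ℕ) : Finset (Finset V) :=
  univ.filter (fun σ : Finset V => σ.card ≤ d) ∪ E

/-- The complex of the complete `(d+1)`-uniform hypergraph on `n` vertices. -/
def completeCx (n d : ℕ) : Finset (Finset (Fin n)) :=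
  univ.filter (fun σ : Finset (Fin n) => σ.card ≤ d + 1)

/-- Coefficientwise inclusion of integral chains into real chains. -/
def castChain (S : Finset (Finset V)) (k : ℕ) : Chain ℤ S k →ₗ[ℤ] Chain ℝ S k :=
  LinearMap.pi fun τ => ((Int.castAddHom ℝ).toIntLinearMap).comp (LinearMap.proj τ)

/-- The integral reduced `(d-1)`-cycles `Z_{d-1}(F; ℤ)` of a `(d+1)`-uniform
hypergraph with edge set `EF`, where `d = k + 1`. -/
def Zcycles (EF : Finset (Finset V)) (k : ℕ) : Submodule ℤ (Chain ℤ (cx EF (k + 1)) (k + 1)) :=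
  LinearMap.ker (bdry ℤ (cx EF (k + 1)) k)

/-- The integral `(d-1)`-boundaries `B_{d-1}(F; ℤ)`, where `d = k + 1`. -/
def Bbdries (EF : Finset (Finset V)) (k : ℕ) : Submodule ℤ (Chain ℤ (cx EF (k + 1)) (k + 1)) :=
  LinearMap.range (bdry ℤ (cx EF (k + 1)) (k + 1))

/-- The lattice `B_{d-1}(F; ℝ) ∩ Z_{d-1}(F; ℤ)`: integral reduced cycles which are
real boundaries, where `d = k + 1`. -/
def realBdryLattice (EF : Finset (Finset V)) (k : ℕ) :
    Submodule ℤ (Chain ℤ (cx EF (k + 1)) (k + 1)) :=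
  Zcycles EF k ⊓
    Submodule.comap (castChain (cx EF (k + 1)) (k + 1))
      ((LinearMap.range (bdry ℝ (cx EF (k + 1)) (k + 1))).restrictScalars ℤ)

/-- An integral linear system that is solvable over `ℝ` becomes solvable over `ℤ` after
multiplying the right-hand side by a suitable nonzero integer. -/
theorem exists_int_solution_of_real_solution {ι κ : Type*} [Fintype ι]
    (A : κ → ι → ℤ) (b : κ → ℤ) (x : ι → ℝ) (hx : ∀ i, ∑ j, (A i j : ℝ) * x j = b i) :
    ∃ n : ℤ, n ≠ 0 ∧ ∃ y : ι → ℤ, ∀ i, ∑ j, A i j * y j = n * b i := by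
  obtain ⟨f, hf⟩ := LinearMap.exists_leftInverse_of_injective (Algebra.linearMap ℚ ℝ)
    (LinearMap.ker_eq_bot.mpr (algebraMap ℚ ℝ).injective)
  have hf' : ∀ q : ℚ, f q = q := fun q => by simpa using LinearMap.congr_fun hf q
  have hq : ∀ i, ∑ j, (A i j : ℚ) * f (x j) = b i := fun i => by
    have h := congrArg f (hx i)
    rw [map_sum] at h
    rw [← hf' (b i), Rat.cast_intCast, ← h]
    refine Finset.sum_congr rfl fun j _ => ?_
    rw [← zsmul_eq_mul, ← zsmul_eq_mul, map_zsmul]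
  obtain ⟨n, hn⟩ := IsLocalization.exist_integer_multiples_of_finite
    (nonZeroDivisors ℤ) (fun j => f (x j))
  choose y hy using hn
  refine ⟨n, nonZeroDivisors.coe_ne_zero n, y, fun i => ?_⟩
  have hy' : ∀ j, (y j : ℚ) = (n : ℤ) * f (x j) := fun j => by simpa using hy j
  have : (∑ j, (A i j : ℚ) * (y j : ℚ)) = (n : ℤ) * (b i : ℚ) := by
    rw [← hq i, Finset.mul_sum]
    exact Finset.sum_congr rfl fun j _ => by rw [hy' j]; ring
  exact_mod_cast this

theorem bdry_apply (R : Type) [CommRing R] (S : Finset (Finset V)) (k : ℕ)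
    (c : Chain R S (k + 1)) (τ : {σ : Finset V // σ ∈ S ∧ σ.card = k}) :
    bdry R S k c τ = ∑ σ, (inc σ.1 τ.1 : R) * c σ := by
  simp [bdry]

theorem castChain_apply (S : Finset (Finset V)) (k : ℕ) (c : Chain ℤ S k)
    (τ : {σ : Finset V // σ ∈ S ∧ σ.card = k}) : castChain S k c τ = (c τ : ℝ) := by
  simp [castChain]

theorem castChain_bdry (S : Finset (Finset V)) (k : ℕ) (c : Chain ℤ S (k + 1)) :
    castChain S k (bdry ℤ S k c) = bdry ℝ S k (castChain S (k + 1) c) := by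
  ext τ
  simp [castChain_apply, bdry_apply]

/-- An integral chain is a real boundary iff some nonzero multiple is an integral boundary. -/
theorem castChain_mem_range_bdry_iff (S : Finset (Finset V)) (k : ℕ) (z : Chain ℤ S k) :
    castChain S k z ∈ LinearMap.range (bdry ℝ S k) ↔
      ∃ n : ℤ, n ≠ 0 ∧ n • z ∈ LinearMap.range (bdry ℤ S k) := by
  constructor
  · rintro ⟨x, hx⟩
    obtain ⟨n, hn, y, hy⟩ := exists_int_solution_of_real_solution
      (fun τ σ => inc σ.1 τ.1) z x fun τ => by
        rw [← bdry_apply, hx, castChain_apply]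
    refine ⟨n, hn, y, funext fun τ => ?_⟩
    simpa [bdry_apply] using hy τ
  · rintro ⟨n, hn, y, hy⟩
    refine ⟨(n : ℝ)⁻¹ • castChain S (k + 1) y, ?_⟩
    rw [map_smul, ← castChain_bdry, hy, inv_smul_eq_iff₀ (Int.cast_ne_zero.mpr hn), map_zsmul,
      Int.cast_smul_eq_zsmul]

/-- If `L ≤ Z` consists of the elements of `Z` having a nonzero multiple in `B`, then the
torsion of `Z / B` is isomorphic to `L / B`. -/
theorem card_torsion_quotient_eq {M : Type*} [AddCommGroup M] (Z B L : Submodule ℤ M)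
    (hL : ∀ z, z ∈ L ↔ z ∈ Z ∧ ∃ n : ℤ, n ≠ 0 ∧ n • z ∈ B) :
    Nat.card (Submodule.torsion ℤ (Z ⧸ B.comap Z.subtype)) = Nat.card (L ⧸ B.comap L.subtype) := by
  have hLZ : L ≤ Z := fun z hz => ((hL z).1 hz).1
  let φ := Submodule.mapQ (B.comap L.subtype) (B.comap Z.subtype) (Submodule.inclusion hLZ)
    fun _ hz => hz
  have hφ : Function.Injective φ := by
    rw [← LinearMap.ker_eq_bot]
    exact Submodule.ker_liftQ_eq_bot _ _ _ fun z hz => by simpa using hz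
  have hrange : Submodule.torsion ℤ (Z ⧸ B.comap Z.subtype) = LinearMap.range φ := by
    ext q
    obtain ⟨z, rfl⟩ := Submodule.Quotient.mk_surjective _ q
    rw [Submodule.mem_torsion_iff]
    constructor
    · rintro ⟨n, hn⟩
      have hnB : (n : ℤ) • (z : M) ∈ B := by
        have : Submodule.Quotient.mk (p := B.comap Z.subtype) ((n : ℤ) • z) = 0 := hn
        simpa using (Submodule.Quotient.mk_eq_zero _).1 this
      exact ⟨Submodule.Quotient.mk
        ⟨z, (hL z).2 ⟨z.2, n, nonZeroDivisors.coe_ne_zero n, hnB⟩⟩, rfl⟩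
    · rintro ⟨w, hw⟩
      obtain ⟨l, rfl⟩ := Submodule.Quotient.mk_surjective _ w
      obtain ⟨-, n, hn, hnB⟩ := (hL l).1 l.2
      refine ⟨⟨n, mem_nonZeroDivisors_of_ne_zero hn⟩, ?_⟩
      rw [← hw]
      exact (Submodule.Quotient.mk_eq_zero (B.comap Z.subtype)
        (x := n • Submodule.inclusion hLZ l)).2 hnB
  rw [hrange]
  exact (Nat.card_congr (LinearEquiv.ofInjective φ hφ).toEquiv).symm

/-- For a spanning hyperforest `F` of a `(d+1)`-uniform hypergraph
`H` (here `d = k + 1`, `F` has edge set `EF ⊆ EH`, and the hyperforest condition is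
`H̃_d(F; ℝ) = 0`, i.e. injectivity of `∂_d` on `C_d(F; ℝ)`), the cardinality of the
torsion subgroup of `H̃_{d-1}(F; ℤ) = Z_{d-1}(F; ℤ)/B_{d-1}(F; ℤ)` equals the index
`[B_{d-1}(F; ℝ) ∩ Z_{d-1}(H; ℤ) : B_{d-1}(F; ℤ)]` (note `Z_{d-1}(H; ℤ) =
Z_{d-1}(F; ℤ)` since `F` and `H` have the same full `(d-1)`-skeleton). -/
theorem card_torsion_eq_index (d k : ℕ) (hdk : d = k + 1)
    (EH EF : Finset (Finset V)) (hEH : ∀ e ∈ EH, e.card = d + 1) (hFH : EF ⊆ EH)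
    (hforest : LinearMap.ker (bdry ℝ (cx EF (k + 1)) (k + 1)) = ⊥) :
    Nat.card (Submodule.torsion ℤ
      (Zcycles EF k ⧸ Submodule.comap (Zcycles EF k).subtype (Bbdries EF k)))
    = Nat.card
      (realBdryLattice EF k ⧸
        Submodule.comap (realBdryLattice EF k).subtype (Bbdries EF k)) := by
  refine card_torsion_quotient_eq _ _ _ fun z => ?_
  rw [realBdryLattice, Submodule.mem_inf]
  exact and_congr_right fun _ => castChain_mem_range_bdry_iff _ _ z
end

section
/- Let $G$ be a connected graph on vertex set $\{v_1,\dots,v_n\}$ and let $\mathcal{Z}_G = \sum_{\{v_i,v_j\} \in E(G)} \operatorname{conv}\{0, e_j - e_i\} \subseteq \mathbb{R}^n$ (taking $i < j$). Then the $(n-1)$-dimensional volume of $\mathcal{Z}_G$, normalized with respect to the lattice $\{x \in \mathbb{Z}^n : \sum x_i = 0\}$, equals the number of spanning trees of $G$. -/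
open Finset MeasureTheory

/-- The coefficientwise inclusion `ℤ^n → ℝ^n`, as a `ℤ`-linear map. -/
def intCast (n : ℕ) : (Fin n → ℤ) →ₗ[ℤ] (Fin n → ℝ) :=
  LinearMap.pi fun i => ((Int.castAddHom ℝ).toIntLinearMap).comp (LinearMap.proj i)

/-- The graphic zonotope of a graph `G` on vertex set `Fin n`: the Minkowski sum of
the segments `conv {0, e_j - e_i}` over the edges `{v_i, v_j}` of `G` with `i < j`. -/
def graphicZonotope (n : ℕ) (G : SimpleGraph (Fin n)) [DecidableRel G.Adj] :
    Set (Fin n → ℝ) :=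
  {x | ∃ c : Fin n × Fin n → ℝ, (∀ p, c p ∈ Set.Icc (0 : ℝ) 1) ∧
    x = ∑ p ∈ univ.filter (fun p : Fin n × Fin n => p.1 < p.2 ∧ G.Adj p.1 p.2),
      c p • (Pi.single p.2 (1 : ℝ) - Pi.single p.1 (1 : ℝ))}

section ZonotopeVolume

variable {ι : Type*}

/-- The first nonzero coordinate of `u` exists and is positive. -/
def LexPos [LinearOrder ι] (u : ι → ℝ) : Prop :=
  ∃ i, (∀ j < i, u j = 0) ∧ 0 < u i

section LexPos

variable [LinearOrder ι] {u w : ι → ℝ}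

lemma LexPos.add (hu : LexPos u) (hw : LexPos w) : LexPos (u + w) := by
  obtain ⟨i, hi, hi'⟩ := hu
  obtain ⟨k, hk, hk'⟩ := hw
  rcases lt_trichotomy i k with h | rfl | h
  · refine ⟨i, fun j hj => ?_, ?_⟩
    · simp [hi j hj, hk j (hj.trans h)]
    · simpa [hk i h] using hi'
  · exact ⟨i, fun j hj => by simp [hi j hj, hk j hj], by simpa using add_pos hi' hk'⟩
  · refine ⟨k, fun j hj => ?_, ?_⟩
    · simp [hk j hj, hi j (hj.trans h)]
    · simpa [hi k h] using hk'

lemma LexPos.smul {r : ℝ} (hr : 0 < r) (hu : LexPos u) : LexPos (r • u) := by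
  obtain ⟨i, hi, hi'⟩ := hu
  exact ⟨i, fun j hj => by simp [hi j hj], by simpa using mul_pos hr hi'⟩

lemma LexPos.ne_zero (hu : LexPos u) : u ≠ 0 := by
  rintro rfl
  obtain ⟨i, -, hi⟩ := hu
  simp at hi

lemma LexPos.not_neg (hu : LexPos u) : ¬ LexPos (-u) := fun h =>
  (hu.add h).ne_zero (add_neg_cancel u)

lemma lexPos_or_lexPos_neg [Finite ι] (hu : u ≠ 0) : LexPos u ∨ LexPos (-u) := by
  have := Fintype.ofFinite ι
  obtain ⟨i, hi⟩ := Function.ne_iff.1 hu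
  have hne : (univ.filter fun i => u i ≠ 0).Nonempty := ⟨i, by simpa using hi⟩
  have hmin := (univ.filter fun i => u i ≠ 0).min'_mem hne
  set k := (univ.filter fun i => u i ≠ 0).min' hne
  have hlt : ∀ j < k, u j = 0 := fun j hj => by
    by_contra h
    exact absurd ((univ.filter fun i => u i ≠ 0).min'_le j (by simpa using h)) (not_le.2 hj)
  rcases lt_or_gt_of_ne (by simpa using hmin : u k ≠ 0) with h | h
  · exact Or.inr ⟨k, fun j hj => by simp [hlt j hj], by simpa using h⟩
  · exact Or.inl ⟨k, hlt, h⟩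

lemma sum_eq_zero_or_lexPos {κ : Type*} (t : Finset κ) (f : κ → ι → ℝ)
    (hf : ∀ k ∈ t, f k = 0 ∨ LexPos (f k)) : ∑ k ∈ t, f k = 0 ∨ LexPos (∑ k ∈ t, f k) := by
  classical
  induction t using Finset.induction_on with
  | empty => simp
  | insert a t ha ih =>
    rw [sum_insert ha]
    rcases hf a (mem_insert_self a t) with h | h <;>
      rcases ih (fun k hk => hf k (mem_insert_of_mem hk)) with h' | h'
    · simp [h, h']
    · exact Or.inr (by simpa [h] using h')
    · exact Or.inr (by simpa [h'] using h)
    · exact Or.inr (h.add h')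

/-- A nonempty compact set has a lexicographically smallest element. -/
lemma IsCompact.exists_lexMin [Finite ι] {K : Set (ι → ℝ)} (hK : IsCompact K)
    (hne : K.Nonempty) : ∃ c ∈ K, ∀ c' ∈ K, c' ≠ c → LexPos (c' - c) := by
  have := Fintype.ofFinite ι
  have key : ∀ t : Finset ι, ∃ L ⊆ K, IsCompact L ∧ L.Nonempty ∧ ∀ c ∈ L, ∀ c' ∈ K,
      (c' ∈ L ∧ ∀ i ∈ t, c' i = c i) ∨
        ∃ i ∈ t, (∀ j ∈ t, j < i → c' j = c j) ∧ c i < c' i := by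
    intro t
    induction t using Finset.induction_on_max with
    | empty => exact ⟨K, subset_rfl, hK, hne, fun c _ c' hc' => Or.inl ⟨hc', by simp⟩⟩
    | insert a t hat ih =>
      obtain ⟨L, hLK, hL, hLne, h⟩ := ih
      obtain ⟨m, hmL, hm⟩ := hL.exists_isMinOn hLne (continuous_apply a).continuousOn
      refine ⟨L ∩ {c | c a = m a}, Set.inter_subset_left.trans hLK,
        hL.inter_right (isClosed_eq (continuous_apply a) continuous_const), ⟨m, hmL, rfl⟩, ?_⟩
      rintro c ⟨hcL, hca⟩ c' hc'
      replace hca : c a = m a := hca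
      rcases h c hcL c' hc' with ⟨hc'L, heq⟩ | ⟨i, hit, hi, hlt⟩
      · rcases (show m a ≤ c' a from hm hc'L).eq_or_lt with h' | h'
        · refine Or.inl ⟨⟨hc'L, h'.symm⟩, fun i hi => ?_⟩
          rcases mem_insert.1 hi with rfl | hi
          · rw [hca, h']
          · exact heq i hi
        · refine Or.inr ⟨a, mem_insert_self a t, fun j hj hja => ?_, hca ▸ h'⟩
          exact heq j ((mem_insert.1 hj).resolve_left hja.ne)
      · refine Or.inr ⟨i, mem_insert_of_mem hit, fun j hj hji => ?_, hlt⟩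
        exact hi j ((mem_insert.1 hj).resolve_left (hji.trans (hat i hit)).ne) hji
  obtain ⟨L, hLK, -, ⟨c, hc⟩, h⟩ := key univ
  refine ⟨c, hLK hc, fun c' hc' hne => ?_⟩
  rcases h c hc c' hc' with ⟨-, h⟩ | ⟨i, -, h, hi⟩
  · exact absurd (funext fun i => h i (mem_univ i)) hne
  · exact ⟨i, fun j hj => by simp [h j (mem_univ j) hj], by simpa using hi⟩

end LexPos

variable [Fintype ι]

open Classical in
/-- The indices at which `c` takes a value strictly between `0` and `1`. -/
noncomputable def fracSupport (c : ι → ℝ) : Finset ι :=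
  univ.filter fun i => 0 < c i ∧ c i < 1

lemma mem_fracSupport {c : ι → ℝ} {i : ι} : i ∈ fracSupport c ↔ 0 < c i ∧ c i < 1 := by
  simp [fracSupport]

lemma eq_zero_or_one_of_notMem_fracSupport {c : ι → ℝ} (hc : c ∈ Set.Icc 0 1) {i : ι}
    (hi : i ∉ fracSupport c) : c i = 0 ∨ c i = 1 := by
  rw [mem_fracSupport, not_and_or, not_lt, not_lt] at hi
  exact hi.imp (fun h => h.antisymm (hc.1 i)) (fun h => (hc.2 i).antisymm h)

/-- A small perturbation of a point of the cube stays in the cube when it points inwards at the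
coordinates equal to `0` or `1`. -/
lemma exists_pos_add_smul_mem_Icc {c u : ι → ℝ} (hc : c ∈ Set.Icc (0 : ι → ℝ) 1)
    (hu : ∀ i, c i = 0 → 0 ≤ u i) (hu' : ∀ i, c i = 1 → u i ≤ 0) :
    ∃ ε : ℝ, 0 < ε ∧ c + ε • u ∈ Set.Icc (0 : ι → ℝ) 1 := by
  have h : ∀ i, ∀ᶠ ε : ℝ in nhdsWithin 0 (Set.Ioi 0), 0 ≤ c i + ε * u i ∧ c i + ε * u i ≤ 1 := by
    intro i
    have ht : Filter.Tendsto (fun ε : ℝ => c i + ε * u i) (nhdsWithin 0 (Set.Ioi 0))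
        (nhds (c i)) := by
      have : Continuous fun ε : ℝ => c i + ε * u i := by fun_prop
      simpa using (this.tendsto 0).mono_left nhdsWithin_le_nhds
    refine Filter.Eventually.and ?_ ?_
    · rcases (show 0 ≤ c i from hc.1 i).eq_or_lt with h0 | h0
      · filter_upwards [self_mem_nhdsWithin] with ε hε
        rw [← h0, zero_add]
        exact mul_nonneg (le_of_lt hε) (hu i h0.symm)
      · exact (ht.eventually_const_lt h0).mono fun _ => le_of_lt
    · rcases (show c i ≤ 1 from hc.2 i).eq_or_lt with h1 | h1
      · filter_upwards [self_mem_nhdsWithin] with ε hε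
        rw [h1]
        linarith [mul_nonpos_of_nonneg_of_nonpos (le_of_lt hε : (0 : ℝ) ≤ ε) (hu' i h1)]
      · exact (ht.eventually_lt_const h1).mono fun _ => le_of_lt
  obtain ⟨ε, h1, h2⟩ := ((Filter.eventually_all.2 h).and self_mem_nhdsWithin).exists
  exact ⟨ε, h2, fun i => (h1 i).1, fun i => (h1 i).2⟩

variable {V : Type*} [NormedAddCommGroup V] [NormedSpace ℝ V]

/-- `c` is the lexicographically smallest point of the cube with a given image under
`c ↦ ∑ i, c i • v i`. -/
def IsLexMinRep [LinearOrder ι] (v : ι → V) (c : ι → ℝ) : Prop :=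
  c ∈ Set.Icc 0 1 ∧ ∀ c' ∈ Set.Icc (0 : ι → ℝ) 1,
    Fintype.linearCombination ℝ v c' = Fintype.linearCombination ℝ v c → c' ≠ c → LexPos (c' - c)

/-- The points of the parallelepiped whose lexicographically smallest representation is fractional
exactly on `s`. -/
def lexCell [LinearOrder ι] (v : ι → V) (s : Finset ι) : Set V :=
  Fintype.linearCombination ℝ v '' {c | IsLexMinRep v c ∧ fracSupport c = s}

lemma iUnion_lexCell [LinearOrder ι] (v : ι → V) :
    ⋃ s ∈ (univ : Finset (Finset ι)), lexCell v s = parallelepiped v := by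
  ext x
  simp only [mem_univ, Set.iUnion_true, Set.mem_iUnion]
  constructor
  · rintro ⟨s, c, ⟨hc, -⟩, rfl⟩
    exact ⟨c, hc.1, rfl⟩
  · rintro ⟨c₀, hc₀, rfl⟩
    have hcont : Continuous (Fintype.linearCombination ℝ v) := by
      simp only [funext (Fintype.linearCombination_apply ℝ v)]
      fun_prop
    obtain ⟨c, ⟨hc, hcx⟩, h⟩ := IsCompact.exists_lexMin
      (K := Set.Icc (0 : ι → ℝ) 1 ∩ Fintype.linearCombination ℝ v ⁻¹'
        {Fintype.linearCombination ℝ v c₀})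
      (isCompact_Icc.inter_right (isClosed_singleton.preimage hcont)) ⟨c₀, hc₀, rfl⟩
    exact ⟨fracSupport c, c, ⟨⟨hc, fun c' hc' hcc' => h c' ⟨hc', hcc'.trans hcx⟩⟩, rfl⟩, hcx⟩

lemma IsLexMinRep.eq [LinearOrder ι] {v : ι → V} {c c' : ι → ℝ} (hc : IsLexMinRep v c)
    (hc' : IsLexMinRep v c')
    (h : Fintype.linearCombination ℝ v c = Fintype.linearCombination ℝ v c') : c = c' := by
  by_contra hne
  have h1 := hc.2 c' hc'.1 h.symm (Ne.symm hne)
  have h2 := hc'.2 c hc.1 h hne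
  rw [← neg_sub] at h2
  exact h1.not_neg h2

lemma disjoint_lexCell [LinearOrder ι] (v : ι → V) {s t : Finset ι} (hst : s ≠ t) :
    Disjoint (lexCell v s) (lexCell v t) := by
  rw [Set.disjoint_left]
  rintro _ ⟨c, ⟨hc, rfl⟩, rfl⟩ ⟨c', ⟨hc', rfl⟩, h⟩
  exact hst (by rw [hc.eq hc' h.symm])

lemma IsLexMinRep.not_lexPos_neg [LinearOrder ι] {v : ι → V} {c : ι → ℝ} (hc : IsLexMinRep v c)
    {u : ι → ℝ} (hA : Fintype.linearCombination ℝ v u = 0)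
    (hu : ∀ i, c i = 0 → 0 ≤ u i) (hu' : ∀ i, c i = 1 → u i ≤ 0) : ¬ LexPos (-u) := by
  intro hpos
  obtain ⟨ε, hε, hmem⟩ := exists_pos_add_smul_mem_Icc hc.1 hu hu'
  have := hc.2 _ hmem (by simp [hA]) (by
    intro h
    have h0 : u = 0 := by simpa [hε.ne'] using h
    exact hpos.ne_zero (by simp [h0]))
  rw [add_sub_cancel_left] at this
  refine this.not_neg ?_
  rw [← smul_neg]
  exact hpos.smul hε

lemma IsLexMinRep.eq_zero_of_support_subset [LinearOrder ι] {v : ι → V} {c : ι → ℝ}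
    (hc : IsLexMinRep v c) {u : ι → ℝ} (hA : Fintype.linearCombination ℝ v u = 0)
    (hu : ∀ i ∉ fracSupport c, u i = 0) : u = 0 := by
  have h01 : ∀ i, c i = 0 ∨ c i = 1 → u i = 0 := fun i hi => hu i fun h => by
    rw [mem_fracSupport] at h
    rcases hi with hi | hi <;> linarith [h.1, h.2]
  by_contra hne
  rcases lexPos_or_lexPos_neg hne with h | h
  · exact hc.not_lexPos_neg (u := -u) (by simp [hA]) (fun i hi => by simp [h01 i (Or.inl hi)])
      (fun i hi => by simp [h01 i (Or.inr hi)]) (by simpa using h)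
  · exact hc.not_lexPos_neg hA (fun i hi => by simp [h01 i (Or.inl hi)])
      (fun i hi => by simp [h01 i (Or.inr hi)]) h

lemma linearIndepOn_iff_linearCombination (v : ι → V) (s : Finset ι) :
    LinearIndepOn ℝ v (s : Set ι) ↔
      ∀ u : ι → ℝ, (∀ i ∉ s, u i = 0) → Fintype.linearCombination ℝ v u = 0 → u = 0 := by
  rw [linearIndepOn_finset_iff]
  constructor
  · intro h u hu hA
    funext i
    by_cases hi : i ∈ s
    · refine h u ?_ i hi
      rw [← hA, Fintype.linearCombination_apply]
      exact sum_subset (subset_univ s) fun i _ hi => by simp [hu i hi]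
    · exact hu i hi
  · classical
    intro h f hf i hi
    have := congrFun (h (fun i => if i ∈ s then f i else 0) (fun i hi => by simp [hi]) (by
      simpa [Fintype.linearCombination_apply, ite_smul, sum_ite_mem] using hf)) i
    simpa [hi] using this

lemma linearIndepOn_of_lexCell_nonempty [LinearOrder ι] {v : ι → V} {s : Finset ι}
    (h : (lexCell v s).Nonempty) : LinearIndepOn ℝ v (s : Set ι) := by
  obtain ⟨_, c, ⟨hc, rfl⟩, -⟩ := h
  rw [linearIndepOn_iff_linearCombination]
  exact fun u hu hA => hc.eq_zero_of_support_subset hA hu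

/-- If `s` indexes a basis, then the lexicographically smallest representations which are
fractional exactly on `s` have prescribed values outside `s`. -/
lemma exists_isLexMinRep_iff [LinearOrder ι] {v : ι → V} {s : Finset ι}
    (hli : LinearIndepOn ℝ v (s : Set ι)) (hsp : ⊤ ≤ Submodule.span ℝ (v '' s)) :
    ∃ σ : ι → ℝ, ∀ c : ι → ℝ, IsLexMinRep v c ∧ fracSupport c = s ↔
      (∀ i ∈ s, 0 < c i ∧ c i < 1) ∧ ∀ i ∉ s, c i = σ i := by
  classical
  rw [linearIndepOn_iff_linearCombination] at hli
  have hex : ∀ e, ∃ u : ι → ℝ, e ∉ s →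
      Fintype.linearCombination ℝ v u = 0 ∧ u e = 1 ∧ ∀ i ∉ s, i ≠ e → u i = 0 := by
    intro e
    obtain ⟨w, hw⟩ := (Submodule.mem_span_image_finset_iff_exists_fun ℝ).1
      (hsp (Submodule.mem_top (x := v e)))
    refine ⟨Pi.single e 1 - fun i => if h : i ∈ s then w ⟨i, h⟩ else 0, fun he => ⟨?_, ?_, ?_⟩⟩
    · rw [map_sub, Fintype.linearCombination_apply_single, one_smul, sub_eq_zero, ← hw]
      rw [Fintype.linearCombination_apply, ← sum_subset (subset_univ s)
        (fun i _ hi => by simp [hi]), ← sum_coe_sort s]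
      exact sum_congr rfl fun i _ => by simp
    · simp [he]
    · intro i hi hie
      simp [hi, hie]
  choose u hu using hex
  refine ⟨fun e => if LexPos (u e) then 0 else 1, fun c => ⟨?_, ?_⟩⟩
  · rintro ⟨hc, rfl⟩
    refine ⟨fun i hi => mem_fracSupport.1 hi, fun e he => ?_⟩
    obtain ⟨hA, hue, hu0⟩ := hu e he
    have hsupp : ∀ i, c i = 0 ∨ c i = 1 → i ≠ e → u e i = 0 := fun i hi hie =>
      hu0 i (fun h => by
        rw [mem_fracSupport] at h
        rcases hi with hi | hi <;> linarith [h.1, h.2]) hie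
    have hne : u e ≠ 0 := fun h => by simp [h] at hue
    dsimp only
    split_ifs with hpos
    · refine (eq_zero_or_one_of_notMem_fracSupport hc.1 he).resolve_right fun h1 => ?_
      refine hc.not_lexPos_neg (u := -u e) (by simp [hA]) (fun i hi => ?_) (fun i hi => ?_)
        (by simpa using hpos)
      · have : i ≠ e := by rintro rfl; simp [hi] at h1
        simp [hsupp i (Or.inl hi) this]
      · by_cases hie : i = e
        · subst hie; simp [hue]
        · simp [hsupp i (Or.inr hi) hie]
    · refine (eq_zero_or_one_of_notMem_fracSupport hc.1 he).resolve_left fun h1 => ?_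
      refine hc.not_lexPos_neg hA (fun i hi => ?_) (fun i hi => ?_)
        ((lexPos_or_lexPos_neg hne).resolve_left hpos)
      · by_cases hie : i = e
        · subst hie; simp [hue]
        · simp [hsupp i (Or.inl hi) hie]
      · have : i ≠ e := by rintro rfl; simp [hi] at h1
        simp [hsupp i (Or.inr hi) this]
  · rintro ⟨hs, hσ⟩
    have h01 : ∀ i ∉ s, c i = 0 ∨ c i = 1 := fun i hi => by
      rw [hσ i hi]; dsimp only; split_ifs <;> simp
    refine ⟨⟨⟨fun i => ?_, fun i => ?_⟩, fun c' hc' hA hne => ?_⟩, ?_⟩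
    · by_cases hi : i ∈ s
      · exact (hs i hi).1.le
      · rcases h01 i hi with h | h <;> simp [h]
    · by_cases hi : i ∈ s
      · exact (hs i hi).2.le
      · rcases h01 i hi with h | h <;> simp [h]
    · have hsum : c' - c = ∑ e ∈ sᶜ, (c' e - c e) • u e := by
        rw [← sub_eq_zero]
        refine hli _ (fun i hi => ?_) ?_
        · rw [Pi.sub_apply, Finset.sum_apply, sum_eq_single_of_mem i (by simpa using hi)]
          · simp [(hu i hi).2.1]
          · intro e he hei
            simp [(hu e (by simpa using he)).2.2 i hi hei.symm]
        · rw [map_sub, map_sub, hA, sub_self, zero_sub, neg_eq_zero, map_sum]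
          exact sum_eq_zero fun e he => by simp [(hu e (by simpa using he)).1]
      rw [hsum]
      refine (sum_eq_zero_or_lexPos _ _ fun e he => ?_).resolve_left fun h => hne ?_
      · have he : e ∉ s := by simpa using he
        have h1 : c e = if LexPos (u e) then 0 else 1 := hσ e he
        have hne : u e ≠ 0 := fun h => by simpa [h] using (hu e he).2.1
        have hl := hc'.1 e
        have hr := hc'.2 e
        rw [Pi.zero_apply] at hl
        rw [Pi.one_apply] at hr
        by_cases hce : c' e = c e
        · simp [hce]
        right
        split_ifs at h1 with hpos
        · exact hpos.smul (by rw [h1] at hce ⊢; simpa using lt_of_le_of_ne hl (Ne.symm hce))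
        · rw [← neg_smul_neg]
          refine ((lexPos_or_lexPos_neg hne).resolve_left hpos).smul ?_
          rw [h1] at hce ⊢
          linarith [lt_of_le_of_ne hr hce]
      · rwa [← hsum, sub_eq_zero] at h
    · ext i
      rw [mem_fracSupport]
      refine ⟨fun h => ?_, hs i⟩
      by_contra hi
      rcases h01 i hi with h' | h' <;> linarith [h.1, h.2]

lemma isCompact_parallelepiped (v : ι → V) : IsCompact (parallelepiped v) :=
  isCompact_Icc.image (by fun_prop)

variable [FiniteDimensional ℝ V] [MeasurableSpace V] [BorelSpace V] (μ : Measure V)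
  [μ.IsAddHaarMeasure]

lemma measure_image_card_fracSupport_lt (v : ι → V) :
    μ (Fintype.linearCombination ℝ v ''
      {c | c ∈ Set.Icc 0 1 ∧ (fracSupport c).card < Module.finrank ℝ V}) = 0 := by
  classical
  refine measure_mono_null (t := ⋃ s : {s : Finset ι // s.card < Module.finrank ℝ V},
    ⋃ t : Finset ι, (AffineSubspace.mk' (∑ i ∈ t, v i)
      (Submodule.span ℝ (s.1.image v : Set V)) : Set V)) ?_ ?_
  · rintro _ ⟨c, ⟨hc, hcard⟩, rfl⟩
    refine Set.mem_iUnion.2 ⟨⟨_, hcard⟩, Set.mem_iUnion.2 ⟨univ.filter fun i => c i = 1, ?_⟩⟩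
    rw [SetLike.mem_coe, AffineSubspace.mem_mk', vsub_eq_sub, Fintype.linearCombination_apply,
      sum_filter, ← sum_sub_distrib]
    refine Submodule.sum_mem _ fun i _ => ?_
    by_cases hi : i ∈ fracSupport c
    · refine Submodule.sub_mem _ (Submodule.smul_mem _ _ (Submodule.subset_span ?_)) ?_
      · exact mem_coe.2 (mem_image_of_mem v hi)
      · rw [if_neg (mem_fracSupport.1 hi).2.ne]
        exact Submodule.zero_mem _
    · rcases eq_zero_or_one_of_notMem_fracSupport hc hi with h | h <;> simp [h]
  · refine measure_iUnion_null fun s => measure_iUnion_null fun t => ?_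
    refine Measure.addHaar_affineSubspace μ _ fun h => ?_
    have h' := congrArg AffineSubspace.direction h
    rw [AffineSubspace.direction_mk', AffineSubspace.direction_top] at h'
    have h1 := finrank_span_finset_le_card (R := ℝ) (s.1.image v)
    rw [Set.finrank, h', finrank_top] at h1
    exact absurd (h1.trans card_image_le) (not_le.2 s.2)

lemma lexCell_ae_eq [LinearOrder ι] {v : ι → V} {s : Finset ι}
    (hli : LinearIndepOn ℝ v (s : Set ι)) (hcard : s.card = Module.finrank ℝ V) :
    ∃ x : V, lexCell v s =ᵐ[μ] (fun y => x + y) '' parallelepiped fun i : s => v i := by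
  classical
  have hsp : ⊤ ≤ Submodule.span ℝ (v '' s) := by
    have := hli.linearIndependent.span_eq_top_of_card_eq_finrank' (by simpa using hcard)
    rw [← Set.image_eq_range] at this
    exact this.ge
  obtain ⟨σ, hσ⟩ := exists_isLexMinRep_iff hli hsp
  set x := ∑ i ∈ sᶜ, σ i • v i
  have hcell : lexCell v s = (fun y => x + y) '' (Fintype.linearCombination ℝ (fun i : s => v i) ''
      {c | ∀ i, 0 < c i ∧ c i < 1}) := by
    rw [lexCell, Set.image_image]
    simp only [hσ]
    have hsum : ∀ c : ι → ℝ, (∀ i ∉ s, c i = σ i) → Fintype.linearCombination ℝ v c =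
        x + Fintype.linearCombination ℝ (fun i : s => v i) (fun i => c i) := by
      intro c hc
      rw [Fintype.linearCombination_apply, Fintype.linearCombination_apply,
        ← sum_compl_add_sum s, sum_coe_sort s (fun i => c i • v i)]
      exact congrArg (· + _) (sum_congr rfl fun i hi => by rw [hc i (by simpa using hi)])
    ext y
    constructor
    · rintro ⟨c, ⟨hc, hc'⟩, rfl⟩
      exact ⟨fun i => c i, fun i => hc i i.2, (hsum c hc').symm⟩
    · rintro ⟨c, hc, rfl⟩
      have h1 : ∀ i (hi : i ∈ s), (if h : i ∈ s then c ⟨i, h⟩ else σ i) = c ⟨i, hi⟩ :=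
        fun i hi => by simp [hi]
      have h2 : ∀ i ∉ s, (if h : i ∈ s then c ⟨i, h⟩ else σ i) = σ i :=
        fun i hi => by simp [hi]
      refine ⟨fun i => if h : i ∈ s then c ⟨i, h⟩ else σ i, ⟨fun i hi => ?_, h2⟩, ?_⟩
      · simpa only [h1 i hi] using hc ⟨i, hi⟩
      · rw [hsum _ h2]
        congr 2
        funext i
        exact h1 i i.2
  refine ⟨x, ?_⟩
  rw [hcell]
  refine Filter.EventuallyLE.antisymm (Filter.Eventually.of_forall ?_) ?_
  · refine Set.image_mono (Set.image_mono fun c hc => ?_)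
    exact ⟨fun i => (hc i).1.le, fun i => (hc i).2.le⟩
  · rw [ae_le_set, ← Set.image_sdiff (add_right_injective x), Set.image_add_left,
      measure_preimage_add]
    refine measure_mono_null ?_ (measure_image_card_fracSupport_lt μ fun i : s => v i)
    rintro _ ⟨⟨c, hc, rfl⟩, hy⟩
    refine ⟨c, ⟨hc, ?_⟩, rfl⟩
    have : fracSupport c ≠ univ := fun h => hy ⟨c, fun i => mem_fracSupport.1 (h ▸ mem_univ i), rfl⟩
    have hlt := card_lt_card (ssubset_univ_iff.2 this)
    rwa [card_univ, Fintype.card_coe, hcard] at hlt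

lemma measure_parallelepiped_eq_zero (v : ι → V) (h : Submodule.span ℝ (Set.range v) ≠ ⊤) :
    μ (parallelepiped v) = 0 := by
  refine measure_mono_null ?_ (Measure.addHaar_submodule μ _ h)
  rintro _ ⟨c, -, rfl⟩
  exact Submodule.sum_mem _ fun i _ => Submodule.smul_mem _ _ (Submodule.subset_span ⟨i, rfl⟩)

/-- The volume of the zonotope generated by a family of vectors is the sum of the volumes of the
parallelepipeds spanned by the subfamilies whose size is the dimension. -/
theorem measure_parallelepiped_eq_sum (v : ι → V) :
    μ (parallelepiped v) = ∑ s ∈ powersetCard (Module.finrank ℝ V) (univ : Finset ι),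
      μ (parallelepiped fun i : s => v i) := by
  classical
  let _ : LinearOrder ι := LinearOrder.lift' (Fintype.equivFin ι) (Fintype.equivFin ι).injective
  have hnull : ∀ s : Finset ι, s.card ≠ Module.finrank ℝ V ∨ ¬ LinearIndepOn ℝ v (s : Set ι) →
      μ (lexCell v s) = 0 := by
    intro s hs
    rcases (lexCell v s).eq_empty_or_nonempty with h | h
    · simp [h]
    · have hli := linearIndepOn_of_lexCell_nonempty h
      have hlt : s.card < Module.finrank ℝ V := lt_of_le_of_ne
        (by simpa using hli.linearIndependent.fintype_card_le_finrank)
        (hs.resolve_right (not_not.2 hli))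
      refine measure_mono_null (Set.image_mono ?_) (measure_image_card_fracSupport_lt μ v)
      rintro c ⟨hc, rfl⟩
      exact ⟨hc.1, hlt⟩
  have hmeas : ∀ s : Finset ι, NullMeasurableSet (lexCell v s) μ := by
    intro s
    by_cases hs : s.card ≠ Module.finrank ℝ V ∨ ¬ LinearIndepOn ℝ v (s : Set ι)
    · exact NullMeasurableSet.of_null (hnull s hs)
    · push Not at hs
      obtain ⟨x, hx⟩ := lexCell_ae_eq μ hs.2 hs.1
      refine NullMeasurableSet.congr (IsCompact.measurableSet ?_).nullMeasurableSet hx.symm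
      exact (isCompact_parallelepiped _).image (by fun_prop)
  rw [← iUnion_lexCell, measure_biUnion_finset₀
    (fun s _ t _ hst => (disjoint_lexCell v hst).aedisjoint) (fun s _ => hmeas s)]
  refine (sum_subset (subset_univ _) ?_).symm.trans (sum_congr rfl ?_)
  · intro s _ hs
    exact hnull s (Or.inl (by simpa using hs))
  · intro s hs
    have hcard : s.card = Module.finrank ℝ V := by simpa using hs
    by_cases hli : LinearIndepOn ℝ v (s : Set ι)
    · obtain ⟨x, hx⟩ := lexCell_ae_eq μ hli hcard
      rw [measure_congr hx, Set.image_add_left, measure_preimage_add]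
    · rw [hnull s (Or.inr hli), measure_parallelepiped_eq_zero]
      intro h
      exact hli (linearIndependent_of_top_le_span_of_card_eq_finrank h.ge (by simpa using hcard))

end ZonotopeVolume

lemma volume_parallelepiped_pi {m : ℕ} (w : Fin m → Fin m → ℝ) :
    volume (parallelepiped w) = ENNReal.ofReal |(Matrix.of w).det| := by
  have h := Measure.addHaar_parallelepiped (Pi.basisFun ℝ (Fin m)) w
  rw [Pi.basisFun_det_apply, Module.Basis.addHaar_def, Module.Basis.parallelepiped_basisFun,
    addHaarMeasure_eq_volume_pi] at h
  exact h

/-- A family of `m` integer vectors generating the lattice `ℤ^m` spans a parallelepiped of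
volume one. -/
lemma volume_parallelepiped_eq_one {m : ℕ} {κ : Type*} [Fintype κ] (hκ : Fintype.card κ = m)
    (N : κ → Fin m → ℤ) (hN : ∀ i, Pi.single i 1 ∈ Submodule.span ℤ (Set.range N)) :
    volume (parallelepiped fun (e : κ) (k : Fin m) => (N e k : ℝ)) = 1 := by
  simp only [Submodule.mem_span_range_iff_exists_fun] at hN
  choose M hM using hN
  let f := (Fintype.equivFinOfCardEq hκ).symm
  rw [← parallelepiped_comp_equiv _ f, volume_parallelepiped_pi]
  have hmul : Matrix.of (fun i j => M i (f j)) * Matrix.of (fun i k => N (f i) k) = 1 := by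
    ext i k
    rw [Matrix.mul_apply, Matrix.one_apply]
    refine (Equiv.sum_comp f (fun e => M i e * N e k)).trans ?_
    simpa [Pi.single_apply, eq_comm] using congrFun (hM i) k
  have hdet := Matrix.isUnit_det_of_left_inverse hmul
  have hcast : (Matrix.of ((fun (e : κ) (k : Fin m) => (N e k : ℝ)) ∘ f)).det =
      ((Matrix.of (fun i k => N (f i) k)).det : ℝ) := by
    rw [Int.cast_det]
    rfl
  rw [hcast, ← Int.cast_abs, Int.isUnit_iff_abs_eq.1 hdet]
  simp

section Graph

variable {n : ℕ}

/-- The edges of `G`, oriented from the smaller to the larger endpoint. -/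
abbrev OrientedEdge (G : SimpleGraph (Fin n)) : Type :=
  {p : Fin n × Fin n // p.1 < p.2 ∧ G.Adj p.1 p.2}

/-- The spanning subgraph with edge set `s`. -/
def edgeSubgraph {G : SimpleGraph (Fin n)} (s : Finset (OrientedEdge G)) :
    SimpleGraph (Fin n) where
  Adj i j := ∃ e ∈ s, e.1 = (i, j) ∨ e.1 = (j, i)
  symm := ⟨fun _ _ ⟨e, he, h⟩ => ⟨e, he, h.symm⟩⟩
  loopless := ⟨fun i ⟨e, _, h⟩ => by
    have := e.2.1
    rcases h with h | h <;> simp [h] at this⟩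

section

variable {G : SimpleGraph (Fin n)}

lemma edgeSubgraph_le (s : Finset (OrientedEdge G)) : edgeSubgraph s ≤ G := by
  rintro i j ⟨e, -, h | h⟩
  · simpa [h] using e.2.2
  · simpa [h] using e.2.2.symm

lemma edgeSubgraph_adj_iff_mem (s : Finset (OrientedEdge G)) (e : OrientedEdge G) :
    (edgeSubgraph s).Adj e.1.1 e.1.2 ↔ e ∈ s := by
  constructor
  · rintro ⟨e', he', h | h⟩
    · rwa [Subtype.ext (show e.1 = e'.1 from h.symm)]
    · have h1 := e.2.1
      have h2 := e'.2.1
      rw [h] at h2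
      exact absurd h1 h2.asymm
  · exact fun h => ⟨e, h, Or.inl rfl⟩

lemma edgeSubgraph_injective :
    Function.Injective (edgeSubgraph : Finset (OrientedEdge G) → SimpleGraph (Fin n)) := by
  intro s t h
  ext e
  rw [← edgeSubgraph_adj_iff_mem, ← edgeSubgraph_adj_iff_mem, h]

lemma exists_edgeSubgraph_eq {T : SimpleGraph (Fin n)} (hT : T ≤ G) :
    ∃ s : Finset (OrientedEdge G), edgeSubgraph s = T := by
  classical
  have := Fintype.ofFinite (OrientedEdge G)
  refine ⟨univ.filter fun e => T.Adj e.1.1 e.1.2, ?_⟩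
  ext i j
  constructor
  · rintro ⟨e, he, h | h⟩
    · simpa [h] using he
    · simpa [h] using (mem_filter.1 he).2.symm
  · intro h
    rcases lt_or_gt_of_ne h.ne with hij | hij
    · exact ⟨⟨(i, j), hij, hT h⟩, by simpa using h, Or.inl rfl⟩
    · exact ⟨⟨(j, i), hij, hT h.symm⟩, by simpa using h.symm, Or.inr rfl⟩

lemma card_edgeSet_edgeSubgraph (s : Finset (OrientedEdge G)) :
    Nat.card (edgeSubgraph s).edgeSet = s.card := by
  rw [← Nat.card_eq_finsetCard s]
  symm
  refine Nat.card_eq_of_bijective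
    (fun e : s => (⟨s(e.1.1.1, e.1.1.2), e.1, e.2, Or.inl rfl⟩ : (edgeSubgraph s).edgeSet)) ⟨?_, ?_⟩
  · intro e e' h
    have h' := congrArg Subtype.val h
    simp only [Sym2.eq_iff] at h'
    have h1 := e.1.2.1
    have h2 := e'.1.2.1
    rcases h' with ⟨h3, h4⟩ | ⟨h3, h4⟩
    · exact Subtype.ext (Subtype.ext (Prod.ext h3 h4))
    · rw [h3, h4] at h1
      exact absurd h1 h2.asymm
  · rintro ⟨x, hx⟩
    induction x using Sym2.ind with
    | _ i j =>
      obtain ⟨e, he, h⟩ := hx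
      refine ⟨⟨e, he⟩, Subtype.ext ?_⟩
      rcases h with h | h
      · simp [h]
      · simp [h, Sym2.eq_swap]

lemma isTree_edgeSubgraph_iff (hn : 1 ≤ n) (s : Finset (OrientedEdge G)) :
    (edgeSubgraph s).IsTree ↔ s.card = n - 1 ∧ (edgeSubgraph s).Connected := by
  rw [SimpleGraph.isTree_iff_connected_and_card, card_edgeSet_edgeSubgraph, Nat.card_fin, and_comm]
  refine and_congr_left fun _ => ?_
  omega

open Classical in
lemma card_filter_connected_eq_card_isTree [Fintype (OrientedEdge G)] (hn : 1 ≤ n) :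
    ((powersetCard (n - 1) (univ : Finset (OrientedEdge G))).filter
      fun s => (edgeSubgraph s).Connected).card =
      Nat.card {T : SimpleGraph (Fin n) // T ≤ G ∧ T.IsTree} := by
  rw [← Nat.card_eq_finsetCard]
  refine Nat.card_eq_of_bijective (fun s => ⟨edgeSubgraph s.1, edgeSubgraph_le s.1,
    (isTree_edgeSubgraph_iff hn s.1).2 (by
      have := s.2
      rwa [mem_filter, mem_powersetCard_univ] at this)⟩) ⟨?_, ?_⟩
  · exact fun s t h => Subtype.ext (edgeSubgraph_injective (congrArg Subtype.val h))
  · rintro ⟨T, hT, hT'⟩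
    obtain ⟨s, rfl⟩ := exists_edgeSubgraph_eq hT
    exact ⟨⟨s, by simpa using (isTree_edgeSubgraph_iff hn s).1 hT'⟩, rfl⟩

end

section Coordinates

variable {d : ℕ}

/-- The coordinates of `e_j - e_r` with respect to a basis `b` of the lattice of integer vectors
with coordinate sum zero. -/
lemma exists_latticeCoords (r : Fin n) {b : Fin d → (Fin n → ℤ)}
    (hb₁ : ∀ i, ∑ j, b i j = 0) (hb₂ : LinearIndependent ℤ b)
    (hb₃ : ∀ x : Fin n → ℤ, ∑ j, x j = 0 → x ∈ Submodule.span ℤ (Set.range b)) :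
    ∃ F : Fin n → Fin d → ℤ,
      (∀ j, ∑ k, F j k • b k = Pi.single j 1 - Pi.single r 1) ∧
      ∀ i, ∑ j, b i j • F j = Pi.single i 1 := by
  have h : ∀ j, ∃ f : Fin d → ℤ, ∑ k, f k • b k = Pi.single j 1 - Pi.single r 1 := fun j =>
    (Submodule.mem_span_range_iff_exists_fun ℤ).1 (hb₃ _ (by simp))
  choose F hF using h
  refine ⟨F, hF, fun i => ?_⟩
  refine (linearIndependent_iff_injective_fintypeLinearCombination.1 hb₂) ?_
  rw [map_sum]
  simp only [map_smul, Fintype.linearCombination_apply_single, one_smul]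
  simp only [Fintype.linearCombination_apply, hF, smul_sub, sum_sub_distrib, ← sum_smul, hb₁,
    zero_smul, sub_zero]
  exact (pi_eq_sum_univ' (b i)).symm

variable {b : Fin d → (Fin n → ℤ)} {F : Fin n → Fin d → ℤ} {r : Fin n}

lemma sum_smul_intCast_latticeCoords
    (hF : ∀ j, ∑ k, F j k • b k = Pi.single j 1 - Pi.single r 1) (j : Fin n) :
    ∑ k, (F j k : ℝ) • intCast n (b k) = Pi.single j (1 : ℝ) - Pi.single r 1 := by
  ext i
  have := congrArg (Int.cast : ℤ → ℝ) (congrFun (hF j) i)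
  simpa [intCast, Pi.single_apply] using this

lemma sum_mul_latticeCoords (hbF : ∀ i, ∑ j, b i j • F j = Pi.single i 1) (c : Fin d → ℝ)
    (k : Fin d) : ∑ j, (∑ i, c i • intCast n (b i)) j * (F j k : ℝ) = c k := by
  have h : ∀ i, ∑ j, (b i j : ℝ) * (F j k : ℝ) = if k = i then 1 else 0 := fun i => by
    have := congrArg (Int.cast : ℤ → ℝ) (congrFun (hbF i) k)
    simpa [Pi.single_apply] using this
  simp only [Finset.sum_apply, sum_mul]
  rw [sum_comm]
  simp only [Pi.smul_apply, smul_eq_mul, mul_assoc, ← mul_sum]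
  simp [intCast, h]

/-- In lattice coordinates, the graphic zonotope is spanned by the coordinate vectors of the
edges. -/
lemma preimage_graphicZonotope (G : SimpleGraph (Fin n)) [DecidableRel G.Adj]
    (hF : ∀ j, ∑ k, F j k • b k = Pi.single j 1 - Pi.single r 1)
    (hbF : ∀ i, ∑ j, b i j • F j = Pi.single i 1) :
    (fun c : Fin d → ℝ => ∑ i, c i • intCast n (b i)) ⁻¹' graphicZonotope n G =
      parallelepiped fun (e : OrientedEdge G) (k : Fin d) =>
        ((F e.1.2 k - F e.1.1 k : ℤ) : ℝ) := by
  have hsum : ∀ t : Fin n × Fin n → ℝ,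
      ∑ p ∈ univ.filter (fun p : Fin n × Fin n => p.1 < p.2 ∧ G.Adj p.1 p.2),
        t p • (Pi.single p.2 (1 : ℝ) - Pi.single p.1 (1 : ℝ) : Fin n → ℝ) =
      ∑ i, (∑ e : OrientedEdge G, t e.1 • fun k => ((F e.1.2 k - F e.1.1 k : ℤ) : ℝ)) i •
        intCast n (b i) := by
    intro t
    simp only [Finset.sum_apply, sum_smul]
    rw [sum_comm, sum_subtype (p := fun p => p.1 < p.2 ∧ G.Adj p.1 p.2) _ (by simp)]
    refine sum_congr rfl fun e _ => ?_
    simp only [Pi.smul_apply, smul_assoc, ← smul_sum, Int.cast_sub, sub_smul, sum_sub_distrib,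
      sum_smul_intCast_latticeCoords hF, sub_sub_sub_cancel_right]
  have hinj : Function.Injective fun c : Fin d → ℝ => ∑ i, c i • intCast n (b i) := by
    intro c c' h
    funext k
    rw [← sum_mul_latticeCoords hbF c k, ← sum_mul_latticeCoords hbF c' k]
    simp only [h]
  ext c
  constructor
  · rintro ⟨t, ht, hc⟩
    rw [hsum] at hc
    exact ⟨fun e => t e.1, ⟨fun e => (ht e.1).1, fun e => (ht e.1).2⟩, (hinj hc).symm⟩
  · rintro ⟨t, ht, rfl⟩
    classical
    refine ⟨fun p => if h : p.1 < p.2 ∧ G.Adj p.1 p.2 then t ⟨p, h⟩ else 0, fun p => ?_, ?_⟩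
    · dsimp only
      split_ifs with h
      · exact ⟨ht.1 ⟨p, h⟩, ht.2 ⟨p, h⟩⟩
      · simp
    · rw [hsum]
      have hval : ∀ e : OrientedEdge G,
          (if h : e.1.1 < e.1.2 ∧ G.Adj e.1.1 e.1.2 then t ⟨e.1, h⟩ else 0) = t e :=
        fun e => dif_pos e.2
      simp only [hval]

lemma volume_parallelepiped_edges (G : SimpleGraph (Fin n)) (s : Finset (OrientedEdge G))
    (hs : s.card = d) (hb₁ : ∀ i, ∑ j, b i j = 0)
    (hF : ∀ j, ∑ k, F j k • b k = Pi.single j 1 - Pi.single r 1)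
    (hbF : ∀ i, ∑ j, b i j • F j = Pi.single i 1) [Decidable (edgeSubgraph s).Connected] :
    volume (parallelepiped fun (e : s) (k : Fin d) => ((F e.1.1.2 k - F e.1.1.1 k : ℤ) : ℝ)) =
      if (edgeSubgraph s).Connected then 1 else 0 := by
  split_ifs with h
  · refine volume_parallelepiped_eq_one (by simpa using hs)
      (fun (e : s) k => F e.1.1.2 k - F e.1.1.1 k) fun i => ?_
    set L := Submodule.span ℤ (Set.range fun (e : s) k => F e.1.1.2 k - F e.1.1.1 k)
    have hadj : ∀ x y, (edgeSubgraph s).Adj x y → F y - F x ∈ L := by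
      rintro x y ⟨e, he, h | h⟩
      · exact Submodule.subset_span ⟨⟨e, he⟩, by simp only [h]; rfl⟩
      · rw [← neg_sub]
        exact L.neg_mem (Submodule.subset_span ⟨⟨e, he⟩, by simp only [h]; rfl⟩)
    have hwalk : ∀ x y, (edgeSubgraph s).Walk x y → F y - F x ∈ L := by
      intro x y p
      induction p with
      | nil => simp
      | cons hxy _ ih =>
        rw [← sub_add_sub_cancel]
        exact L.add_mem ih (hadj _ _ hxy)
    have : Pi.single i 1 = ∑ j, b i j • (F j - F r) := by
      rw [← hbF i]
      simp only [smul_sub, sum_sub_distrib, ← sum_smul, hb₁, zero_smul, sub_zero]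
    rw [this]
    exact L.sum_mem fun j _ => L.smul_mem _ (hwalk r j (h.preconnected r j).some)
  · classical
    refine measure_parallelepiped_eq_zero volume _ fun hsp => h ?_
    rw [SimpleGraph.connected_iff_exists_forall_reachable]
    refine ⟨r, fun j => ?_⟩
    by_contra hj
    let φ : (Fin d → ℝ) →ₗ[ℝ] ℝ :=
      (Fintype.linearCombination ℝ fun x : Fin n =>
        if (edgeSubgraph s).Reachable r x then (1 : ℝ) else 0) ∘ₗ
      Fintype.linearCombination ℝ fun i => intCast n (b i)
    have hφ : ∀ x, φ (fun k => (F x k : ℝ)) =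
        (if (edgeSubgraph s).Reachable r x then 1 else 0) - 1 := by
      intro x
      rw [LinearMap.comp_apply, Fintype.linearCombination_apply ℝ (fun i => intCast n (b i)),
        sum_smul_intCast_latticeCoords hF, map_sub]
      simp only [Fintype.linearCombination_apply_single]
      simp
    have hzero : φ = 0 := by
      refine LinearMap.ext_on_range hsp fun e => ?_
      have hadj : (edgeSubgraph s).Adj e.1.1.1 e.1.1.2 := ⟨e.1, e.2, Or.inl rfl⟩
      have hiff : (edgeSubgraph s).Reachable r e.1.1.1 ↔ (edgeSubgraph s).Reachable r e.1.1.2 :=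
        ⟨fun h => h.trans hadj.reachable, fun h => h.trans hadj.symm.reachable⟩
      have : (fun k => ((F e.1.1.2 k - F e.1.1.1 k : ℤ) : ℝ)) =
          (fun k => (F e.1.1.2 k : ℝ)) - fun k => (F e.1.1.1 k : ℝ) := by
        ext k; simp
      rw [this, map_sub, hφ, hφ]
      simp [hiff]
    have := hφ j
    simp [hj, hzero] at this

end Coordinates

end Graph

/-- For a connected graph `G` on `n` vertices, the
`(n-1)`-dimensional volume of the graphic zonotope `𝒵_G`, normalized with respect to
the lattice `{x ∈ ℤ^n : ∑ xᵢ = 0}`, equals the number of spanning trees of `G`: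
concretely, for any `ℤ`-basis `b` of that lattice, the Lebesgue volume of the
preimage of `𝒵_G` under the coordinate map `(c_i) ↦ ∑ c_i • b i` equals the number
of subgraphs `T ≤ G` that are trees (such a `T` is automatically spanning). -/
theorem graphicZonotope_volume_eq_card_spanningTrees (n : ℕ) (hn : 1 ≤ n)
    (G : SimpleGraph (Fin n)) [DecidableRel G.Adj] (hG : G.Connected)
    (b : Fin (n - 1) → (Fin n → ℤ))
    (hb₁ : ∀ i, ∑ j, b i j = 0)
    (hb₂ : LinearIndependent ℤ b)
    (hb₃ : ∀ x : Fin n → ℤ, ∑ j, x j = 0 → x ∈ Submodule.span ℤ (Set.range b)) :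
    (volume ((fun c : Fin (n - 1) → ℝ => ∑ i, c i • intCast n (b i)) ⁻¹'
        graphicZonotope n G)).toReal
      = Nat.card {T : SimpleGraph (Fin n) // T ≤ G ∧ T.IsTree} := by
  classical
  obtain ⟨F, hF, hbF⟩ := exists_latticeCoords (⟨0, hn⟩ : Fin n) hb₁ hb₂ hb₃
  rw [preimage_graphicZonotope G hF hbF, measure_parallelepiped_eq_sum, Module.finrank_fin_fun,
    sum_congr rfl fun s hs =>
      volume_parallelepiped_edges G s (mem_powersetCard.1 hs).2 hb₁ hF hbF,
    sum_boole, card_filter_connected_eq_card_isTree hn]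
  simp
end
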